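/- Let U be a normal ultrafilter on a measurable cardinal δ and let λ be a limit ordinal with cof(λ) > 2^δ. If there exists a <(2^δ)⁺-closed ultrafilter on cof(λ) that contains all cobounded subsets of cof(λ), then no unbounded subset of λ is fresh over Ult(V,U). -/

import Mathlib

noncomputable section

open Cardinal Set

namespace MU

/-- The type of ordinals below the initial ordinal of `δ`, serving as the underlying
set of the cardinal `δ` and indexing the ultrapower. -/
abbrev Idx (δ : Cardinal.{0}) : Type 1 := {o : Ordinal.{0} // o < δ.ord}

/-- A filter `F` is `κ`-complete (equivalently, `<κ`-closed): it is closed under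
intersections of fewer than `κ` of its members. -/
def IsCComplete (κ : Cardinal.{0}) {X : Type*} (F : Filter X) : Prop :=
  ∀ (ι : Type) (t : ι → Set X), #ι < κ → (∀ j, t j ∈ F) → (⋂ j, t j) ∈ F

/-- `U` is a normal ultrafilter on the measurable cardinal `δ`: `δ` is uncountable and
`U` is a `δ`-complete nonprincipal ultrafilter on `δ` such that every function that is
regressive on a set in `U` is constant on a set in `U`. -/
structure IsNormalUltrafilter (δ : Cardinal.{0}) (U : Ultrafilter (Idx δ)) : Prop where
  uncountable : ℵ₀ < δ
  complete : IsCComplete δ (U : Filter (Idx δ))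
  nonprincipal : ∀ i : Idx δ, ({i} : Set (Idx δ)) ∉ U
  normal : ∀ f : Idx δ → Ordinal.{0}, { i : Idx δ | f i < i.1 } ∈ U →
    ∃ c : Ordinal.{0}, { i : Idx δ | f i = c } ∈ U

variable {δ : Cardinal.{0}} {U : Ultrafilter (Idx δ)}

/-- The Łoś ordering on representatives of ordinals of the ultrapower `Ult(V,U)`. -/
def ultLT (U : Ultrafilter (Idx δ)) (f g : Idx δ → Ordinal.{0}) : Prop :=
  { i : Idx δ | f i < g i } ∈ U

theorem ultLT_wf (hU : IsNormalUltrafilter δ U) : WellFounded (ultLT U) := by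
  haveI : IsIrrefl (Idx δ → Ordinal.{0}) (ultLT U) := by
    constructor
    intro f hf
    have h : ({ i : Idx δ | f i < f i } : Set (Idx δ)) = ∅ := by ext i; simp
    rw [ultLT, h] at hf
    exact Filter.empty_notMem (U : Filter (Idx δ)) hf
  haveI : IsTrans (Idx δ → Ordinal.{0}) (ultLT U) := by
    constructor
    intro f g h hfg hgh
    have hsub : ({ i : Idx δ | f i < g i } ∩ { i : Idx δ | g i < h i } : Set (Idx δ)) ⊆
        { i : Idx δ | f i < h i } := fun i hi => show f i < h i from lt_trans hi.1 hi.2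
    exact Filter.mem_of_superset (Filter.inter_mem hfg hgh) hsub
  haveI : IsStrictOrder (Idx δ → Ordinal.{0}) (ultLT U) := ⟨⟩
  rw [RelEmbedding.wellFounded_iff_isEmpty]
  constructor
  intro g
  have hmem : ∀ n : ℕ, { i : Idx δ | g (n + 1) i < g n i } ∈ U :=
    fun n => g.map_rel_iff.2 (Nat.lt_succ_self n)
  have hint : (⋂ n : ℕ, { i : Idx δ | g (n + 1) i < g n i }) ∈ U := by
    refine hU.complete ℕ _ ?_ hmem
    rw [Cardinal.mk_nat]
    exact hU.uncountable
  obtain ⟨i, hi⟩ := Ultrafilter.nonempty_of_mem hint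
  have hdesc : ∀ n : ℕ, (fun n => g n i) (n + 1) < (fun n => g n i) n :=
    fun n => Set.mem_iInter.1 hi n
  exact (RelEmbedding.wellFounded_iff_isEmpty.1 Ordinal.lt_wf).false
    (RelEmbedding.natGT (fun n => g n i) hdesc)

/-- The ordinal represented by `f` in the transitive collapse of the ultrapower
`Ult(V,U)`, i.e. the rank of `f` in the (well-founded) Łoś ordering. -/
def ordRank (hU : IsNormalUltrafilter δ U) (f : Idx δ → Ordinal.{0}) : Ordinal.{0} :=
  sInf { o : Ordinal.{0} | Ordinal.lift.{1} o = ((ultLT_wf hU).apply f).rank }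

/-- The image of an ordinal under the ultrapower embedding `j_U : V → Ult(V,U)`. -/
def jU (hU : IsNormalUltrafilter δ U) (o : Ordinal.{0}) : Ordinal.{0} :=
  ordRank hU fun _ => o

/-- The set of ordinals that is the transitive collapse of the element of the
ultrapower `Ult(V,U)` represented by the function `f`. -/
def ultSet (hU : IsNormalUltrafilter δ U) (f : Idx δ → Set Ordinal.{0}) :
    Set Ordinal.{0} :=
  { o : Ordinal.{0} |
    ∃ g : Idx δ → Ordinal.{0}, { i : Idx δ | g i ∈ f i } ∈ U ∧ ordRank hU g = o }

/-- A set of ordinals is (the transitive collapse of) an element of the ultrapower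
`Ult(V,U)`. -/
def InUlt (hU : IsNormalUltrafilter δ U) (A : Set Ordinal.{0}) : Prop :=
  ∃ f : Idx δ → Set Ordinal.{0}, (∀ i, BddAbove (f i)) ∧ A = ultSet hU f

/-- The least upper bound of a set of ordinals. -/
def lub (A : Set Ordinal.{0}) : Ordinal.{0} :=
  sSup ((fun o => o + 1) '' A)

/-- Hamkins: a set `A` of ordinals is fresh over `Ult(V,U)` if `A ∉ Ult(V,U)` but
`A ∩ α ∈ Ult(V,U)` for every `α < lub A`. -/
def Fresh (hU : IsNormalUltrafilter δ U) (A : Set Ordinal.{0}) : Prop :=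
  ¬ InUlt hU A ∧ ∀ α < lub A, InUlt hU (A ∩ Iio α)

/-- `A` is an unbounded subset of the ordinal `l`. -/
def UnbSub (A : Set Ordinal.{0}) (l : Ordinal.{0}) : Prop :=
  A ⊆ Iio l ∧ ∀ b < l, ∃ a ∈ A, b ≤ a

/-- `A` is a closed subset of the ordinal `l`: it contains the suprema of all of its
nonempty subsets that are bounded below `l`. -/
def ClosedIn (A : Set Ordinal.{0}) (l : Ordinal.{0}) : Prop :=
  ∀ S ⊆ A, S.Nonempty → sSup S < l → sSup S ∈ A

/-- The set of limit points of a set of ordinals. -/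
def limitPts (A : Set Ordinal.{0}) : Set Ordinal.{0} :=
  { b : Ordinal.{0} | (A ∩ Iio b).Nonempty ∧ sSup (A ∩ Iio b) = b }

/-- `S` is a stationary subset of the ordinal `l`. -/
def StationaryIn (S : Set Ordinal.{0}) (l : Ordinal.{0}) : Prop :=
  S ⊆ Iio l ∧ ∀ D : Set Ordinal.{0}, ClosedIn D l → UnbSub D l → (S ∩ D).Nonempty

/-- The order type of the set of ordinals `C` is at most `o`. -/
def otpLE (C : Set Ordinal.{0}) (o : Ordinal.{0}) : Prop :=
  ∃ g : Ordinal.{0} → Ordinal.{0}, (∀ a ∈ C, g a < o) ∧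
    ∀ a ∈ C, ∀ b ∈ C, a < b → g a < g b

/-- The order type of the set of ordinals `C` is (strictly) less than `o`. -/
def otpLT (C : Set Ordinal.{0}) (o : Ordinal.{0}) : Prop :=
  ∃ o' < o, otpLE C o'

/-- `C` is a `□(Θ)`-sequence, where `Θ` is (the initial ordinal of) an uncountable
regular cardinal. -/
structure IsSquareSeq (Θ : Ordinal.{0}) (C : Ordinal.{0} → Set Ordinal.{0}) : Prop where
  closed : ∀ γ < Θ, Order.IsSuccLimit γ → ClosedIn (C γ) γ
  unbounded : ∀ γ < Θ, Order.IsSuccLimit γ → UnbSub (C γ) γ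
  coherent : ∀ γ < Θ, Order.IsSuccLimit γ → ∀ β ∈ limitPts (C γ), β < γ → C β = C γ ∩ Iio β
  nontrivial : ¬ ∃ D : Set Ordinal.{0}, ClosedIn D Θ ∧ UnbSub D Θ ∧
    ∀ γ ∈ limitPts D, γ < Θ → D ∩ Iio γ = C γ

/-- `C` is a `□_κ`-sequence: a `□(κ⁺)`-sequence all of whose clubs have order type
at most `κ`. -/
def IsSquareKappaSeq (κ : Cardinal.{0}) (C : Ordinal.{0} → Set Ordinal.{0}) : Prop :=
  IsSquareSeq (Order.succ κ).ord C ∧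
    ∀ γ < (Order.succ κ).ord, Order.IsSuccLimit γ → otpLE (C γ) κ.ord

/-- `κ` is a weakly compact cardinal: `κ` is uncountable and every coloring of the
pairs of ordinals below `κ` in fewer than `κ` colors has a homogeneous set of size `κ`. -/
def IsWeaklyCompact (κ : Cardinal.{0}) : Prop :=
  ℵ₀ < κ ∧ ∀ (ν : Type) (c : Ordinal.{0} → Ordinal.{0} → ν), #ν < κ →
    ∃ H : Set Ordinal.{0}, H ⊆ Iio κ.ord ∧ Cardinal.lift.{1} κ ≤ #H ∧
      ∀ a ∈ H, ∀ b ∈ H, ∀ a' ∈ H, ∀ b' ∈ H, a < b → a' < b' → c a b = c a' b'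

/-- `κ` is a strongly compact cardinal: every `κ`-complete filter (on any set)
extends to a `κ`-complete ultrafilter. -/
def IsStronglyCompact (κ : Cardinal.{0}) : Prop :=
  ∀ (X : Type) (F : Filter X), IsCComplete κ F →
    ∃ G : Ultrafilter X, F ≤ (G : Filter X) ∧ IsCComplete κ (G : Filter X)

/-- `κ` is a singular cardinal. -/
def IsSingular (κ : Cardinal.{0}) : Prop :=
  ℵ₀ ≤ κ ∧ κ.ord.cof < κ

/-- The cofinality of the ordinal `l` as computed inside the ultrapower `Ult(V,U)`
(as an ordinal, i.e. the image of the ultrapower's cofinality under the transitive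
collapse). -/
def cofUlt (hU : IsNormalUltrafilter δ U) (l : Ordinal.{0}) : Ordinal.{0} :=
  sInf { c : Ordinal.{0} | ∃ f : Idx δ → Ordinal.{0},
    ordRank hU f = l ∧ ordRank hU (fun i => ((f i).cof).ord) = c }

/-- The ordinal `o` is (the transitive collapse of) a cardinal of the ultrapower
`Ult(V,U)`. -/
def CardInUlt (hU : IsNormalUltrafilter δ U) (o : Ordinal.{0}) : Prop :=
  ∃ f : Idx δ → Ordinal.{0}, ordRank hU f = o ∧
    { i : Idx δ | ((f i).card).ord = f i } ∈ U

/-- The ordinal `o` is (the transitive collapse of) a regular cardinal of the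
ultrapower `Ult(V,U)`. -/
def RegularInUlt (hU : IsNormalUltrafilter δ U) (o : Ordinal.{0}) : Prop :=
  ∃ f : Idx δ → Ordinal.{0}, ordRank hU f = o ∧
    { i : Idx δ | ((f i).card).IsRegular ∧ ((f i).card).ord = f i } ∈ U

/-- The cardinal successor of the ordinal `o` as computed inside the ultrapower
`Ult(V,U)`: the least ordinal above `o` that is a cardinal in `Ult(V,U)`. -/
def succInUlt (hU : IsNormalUltrafilter δ U) (o : Ordinal.{0}) : Ordinal.{0} :=
  sInf { c : Ordinal.{0} | o < c ∧ CardInUlt hU c }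

/-- The cardinality of a set of ordinals, as an (initial) ordinal: the least ordinal
`o` such that `s` is the image of a function defined on the ordinals below `o`. -/
def setCardOrd (s : Set Ordinal.{0}) : Ordinal.{0} :=
  sInf { o : Ordinal.{0} | ∃ g : Ordinal.{0} → Ordinal.{0}, s ⊆ g '' Iio o }

/-! ### Ranks of representatives in the ultrapower -/

instance small_idx (κ : Cardinal.{0}) : Small.{0} (Idx κ) :=
  inferInstanceAs (Small.{0} (Iio κ.ord))

theorem acc_rank_le_of_le (hU : IsNormalUltrafilter δ U) {f g : Idx δ → Ordinal.{0}}
    (h : { i : Idx δ | f i ≤ g i } ∈ U) :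
    ((ultLT_wf hU).apply f).rank ≤ ((ultLT_wf hU).apply g).rank := by
  rw [Acc.rank_eq]
  refine Ordinal.iSup_le fun b => Order.succ_le_of_lt ?_
  refine Acc.rank_lt_of_rel ((ultLT_wf hU).apply g) (a := b.1) ?_
  exact Filter.mem_of_superset (Filter.inter_mem b.2 h) fun i hi =>
    show b.1 i < g i from lt_of_lt_of_le hi.1 hi.2

theorem lift_ordRank (hU : IsNormalUltrafilter δ U) (f : Idx δ → Ordinal.{0}) :
    Ordinal.lift.{1} (ordRank hU f) = ((ultLT_wf hU).apply f).rank := by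
  suffices h : ∃ o : Ordinal.{0}, Ordinal.lift.{1} o = ((ultLT_wf hU).apply f).rank from
    csInf_mem (s := { o : Ordinal.{0} | Ordinal.lift.{1} o = ((ultLT_wf hU).apply f).rank }) h
  induction f using (ultLT_wf hU).induction with
  | _ f ih =>
    have bdd : BddAbove (range fun p : ∀ i : Idx δ, Iio (f i + 1) =>
        ordRank hU fun i => (p i).1) := Ordinal.bddAbove_of_small
    obtain ⟨s, hs⟩ := bdd
    suffices h : ((ultLT_wf hU).apply f).rank ≤ Ordinal.lift.{1} (s + 1) by
      obtain ⟨o, ho⟩ := Ordinal.mem_range_lift_of_le h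
      exact ⟨o, ho⟩
    rw [Acc.rank_eq]
    refine Ordinal.iSup_le fun ⟨b, hb⟩ => Order.succ_le_of_lt ?_
    have hmin : { i : Idx δ | min (b i) (f i) = b i } ∈ U :=
      Filter.mem_of_superset hb fun i hi => min_eq_left (le_of_lt hi)
    have hlt : ultLT U (fun i => min (b i) (f i)) f :=
      Filter.mem_of_superset hb fun i hi =>
        show min (b i) (f i) < f i from lt_of_le_of_lt (min_le_left _ _) hi
    have hmem : Ordinal.lift.{1} (ordRank hU fun i => min (b i) (f i)) =
        ((ultLT_wf hU).apply fun i => min (b i) (f i)).rank :=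
      csInf_mem (s := { o : Ordinal.{0} | Ordinal.lift.{1} o =
        ((ultLT_wf hU).apply fun i => min (b i) (f i)).rank }) (ih _ hlt)
    have hle : ordRank hU (fun i => min (b i) (f i)) ≤ s :=
      hs ⟨fun i => ⟨min (b i) (f i), mem_Iio.2 (Order.lt_add_one_iff.2 (min_le_right _ _))⟩,
        rfl⟩
    calc ((ultLT_wf hU).apply b).rank
        ≤ ((ultLT_wf hU).apply fun i => min (b i) (f i)).rank :=
          acc_rank_le_of_le hU (Filter.mem_of_superset hmin fun i hi => le_of_eq (Eq.symm hi))
      _ = Ordinal.lift.{1} (ordRank hU fun i => min (b i) (f i)) := hmem.symm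
      _ < Ordinal.lift.{1} (s + 1) := Ordinal.lift_lt.2 (Order.lt_add_one_iff.2 hle)

theorem ordRank_le_of_le (hU : IsNormalUltrafilter δ U) {f g : Idx δ → Ordinal.{0}}
    (h : { i : Idx δ | f i ≤ g i } ∈ U) : ordRank hU f ≤ ordRank hU g := by
  rw [← Ordinal.lift_le.{1}, lift_ordRank, lift_ordRank]
  exact acc_rank_le_of_le hU h

theorem ordRank_lt_iff (hU : IsNormalUltrafilter δ U) {f g : Idx δ → Ordinal.{0}} :
    ordRank hU f < ordRank hU g ↔ { i : Idx δ | f i < g i } ∈ U := by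
  constructor
  · intro h
    by_contra hn
    refine absurd (ordRank_le_of_le hU ?_) (not_le_of_gt h)
    exact Filter.mem_of_superset (Ultrafilter.compl_mem_iff_notMem.2 hn) fun i hi =>
      show g i ≤ f i from not_lt.1 fun h' => hi h'
  · intro h
    rw [← Ordinal.lift_lt.{1}, lift_ordRank, lift_ordRank]
    exact Acc.rank_lt_of_rel _ h

theorem ordRank_eq_iff (hU : IsNormalUltrafilter δ U) {f g : Idx δ → Ordinal.{0}} :
    ordRank hU f = ordRank hU g ↔ { i : Idx δ | f i = g i } ∈ U := by
  constructor
  · intro h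
    have h₁ := Ultrafilter.compl_mem_iff_notMem.2 (mt (ordRank_lt_iff hU).2 h.not_lt)
    have h₂ := Ultrafilter.compl_mem_iff_notMem.2 (mt (ordRank_lt_iff hU).2 h.not_gt)
    exact Filter.mem_of_superset (Filter.inter_mem h₁ h₂) fun i hi =>
      show f i = g i from le_antisymm (not_lt.1 fun h' => hi.2 h') (not_lt.1 fun h' => hi.1 h')
  · intro h
    exact le_antisymm
      (ordRank_le_of_le hU (Filter.mem_of_superset h fun i hi => le_of_eq hi))
      (ordRank_le_of_le hU (Filter.mem_of_superset h fun i hi => le_of_eq (Eq.symm hi)))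

theorem le_jU (hU : IsNormalUltrafilter δ U) (o : Ordinal.{0}) : o ≤ jU hU o := by
  have hmono : StrictMono (jU hU) := fun a b hab =>
    (ordRank_lt_iff hU).2 (Filter.mem_of_superset Filter.univ_mem fun _ _ => hab)
  exact hmono.le_apply

theorem ordRank_surjective (hU : IsNormalUltrafilter δ U) :
    Function.Surjective (ordRank hU) := by
  intro o
  have h := Ordinal.lift_le.{1}.2 (le_jU hU o)
  rw [jU, lift_ordRank] at h
  obtain ⟨g, hg, hgo⟩ := Acc.mem_range_rank_of_le _ h
  exact ⟨g, Ordinal.lift_inj.{1}.1 ((lift_ordRank hU g).trans hgo)⟩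

theorem ordRank_mem_ultSet (hU : IsNormalUltrafilter δ U) {f : Idx δ → Set Ordinal.{0}}
    {h : Idx δ → Ordinal.{0}} :
    ordRank hU h ∈ ultSet hU f ↔ { i : Idx δ | h i ∈ f i } ∈ U := by
  constructor
  · rintro ⟨g, hg, hgh⟩
    refine Filter.mem_of_superset (Filter.inter_mem hg ((ordRank_eq_iff hU).1 hgh)) ?_
    rintro i ⟨hi, hi'⟩
    exact show h i ∈ f i from (show g i = h i from hi') ▸ (show g i ∈ f i from hi)
  · exact fun hh => ⟨h, hh, rfl⟩

theorem subset_of_ultSet_subset (hU : IsNormalUltrafilter δ U) {f f' : Idx δ → Set Ordinal.{0}}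
    (h : ultSet hU f ⊆ ultSet hU f') : { i : Idx δ | f i ⊆ f' i } ∈ U := by
  by_contra hn
  have hc := Ultrafilter.compl_mem_iff_notMem.2 hn
  have hw : ∀ i : Idx δ, ∃ x : Ordinal.{0}, ¬ f i ⊆ f' i → x ∈ f i ∧ x ∉ f' i := by
    intro i
    by_cases hi : f i ⊆ f' i
    · exact ⟨0, fun h' => absurd hi h'⟩
    · obtain ⟨x, hx⟩ := not_subset.1 hi
      exact ⟨x, fun _ => hx⟩
  choose w hw using hw
  have hmem : ordRank hU w ∈ ultSet hU f :=
    (ordRank_mem_ultSet hU).2 (Filter.mem_of_superset hc fun i hi => (hw i hi).1)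
  have hmem' := (ordRank_mem_ultSet hU).1 (h hmem)
  obtain ⟨i, hi, hi'⟩ := Ultrafilter.nonempty_of_mem (Filter.inter_mem hc hmem')
  exact (hw i hi).2 hi'

theorem ultSet_inter_Iio (hU : IsNormalUltrafilter δ U) (f : Idx δ → Set Ordinal.{0})
    (g : Idx δ → Ordinal.{0}) :
    ultSet hU (fun i => f i ∩ Iio (g i)) = ultSet hU f ∩ Iio (ordRank hU g) := by
  ext o
  obtain ⟨h, rfl⟩ := ordRank_surjective hU o
  rw [mem_inter_iff, mem_Iio, ordRank_mem_ultSet, ordRank_mem_ultSet, ordRank_lt_iff]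
  exact Filter.inter_mem_iff

theorem ultSet_congr (hU : IsNormalUltrafilter δ U) {f f' : Idx δ → Set Ordinal.{0}}
    (h : { i : Idx δ | f i = f' i } ∈ U) : ultSet hU f = ultSet hU f' := by
  ext o
  obtain ⟨g, rfl⟩ := ordRank_surjective hU o
  rw [ordRank_mem_ultSet, ordRank_mem_ultSet]
  refine Filter.congr_sets (Filter.mem_of_superset h fun i hi => ?_)
  change g i ∈ f i ↔ g i ∈ f' i
  rw [show f i = f' i from hi]

theorem ultSet_eq_iff (hU : IsNormalUltrafilter δ U) {f f' : Idx δ → Set Ordinal.{0}} :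
    ultSet hU f = ultSet hU f' ↔ { i : Idx δ | f i = f' i } ∈ U := by
  refine ⟨fun h => ?_, ultSet_congr hU⟩
  exact Filter.mem_of_superset (Filter.inter_mem (subset_of_ultSet_subset hU h.subset)
    (subset_of_ultSet_subset hU h.superset)) fun i hi => Subset.antisymm hi.1 hi.2

/-! ### Pigeonhole and cofinal sequences -/

/-- An ultrafilter closed under intersections of length `2 ^ δ` concentrates every coloring by
subsets of `δ` on a single color. -/
theorem exists_fiber_mem {X : Type*} {F : Ultrafilter X}
    (hF : IsCComplete (Order.succ ((2 : Cardinal.{0}) ^ δ)) (F : Filter X))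
    (c : X → Set (Idx δ)) : ∃ W : Set (Idx δ), { x | c x = W } ∈ F := by
  by_contra! hn
  let e := equivShrink.{0} (Idx δ)
  have hcard : #(Set (Shrink.{0} (Idx δ))) < Order.succ ((2 : Cardinal.{0}) ^ δ) := by
    rw [Order.lt_succ_iff, Cardinal.mk_set]
    have hδ : Cardinal.lift.{1} #(Shrink.{0} (Idx δ)) = Cardinal.lift.{1} δ := by
      rw [Cardinal.lift_mk_shrink''.{1, 0}, show #(Idx δ) = Cardinal.lift.{1} δ.ord.card from
        Cardinal.mk_Iio_ordinal δ.ord, Cardinal.card_ord]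
    rw [Cardinal.lift_inj.1 hδ]
  have hint := hF _ (fun W => { x | c x = e ⁻¹' W }ᶜ) hcard fun W =>
    Ultrafilter.compl_mem_iff_notMem.2 (hn _)
  obtain ⟨x, hx⟩ := Ultrafilter.nonempty_of_mem hint
  refine mem_iInter.1 hx (e '' c x) ?_
  exact (preimage_image_eq _ e.injective).symm

theorem exists_cofinal_sequence {l : Ordinal.{0}} (hl : Order.IsSuccLimit l) :
    ∃ a : Idx l.cof → Ordinal.{0}, (∀ ξ, a ξ < l) ∧
      ∀ x < l, ∃ b < l.cof.ord, ∀ ξ : Idx l.cof, b ≤ ξ.1 → x < a ξ := by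
  obtain ⟨a, ha⟩ := Ordinal.exists_isFundamentalSeq (o := l) rfl
  refine ⟨fun ξ => (a ξ).1, fun ξ => (a ξ).2, fun x hx => ?_⟩
  obtain ⟨_, ⟨b, rfl⟩, hb⟩ := ha.isCofinal_range ⟨x + 1, hl.add_one_lt hx⟩
  refine ⟨b.1, b.2, fun ξ hξ => ?_⟩
  have h : x + 1 ≤ (a b).1 := hb
  have h' : (a b).1 ≤ (a ξ).1 := ha.strictMono.monotone hξ
  exact lt_of_lt_of_le (lt_add_one x) (h.trans h')

theorem lt_lub_of_unbSub {A : Set Ordinal.{0}} {l x : Ordinal.{0}} (hA : UnbSub A l)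
    (hx : x < l) : x < lub A := by
  obtain ⟨y, hy, hxy⟩ := hA.2 x hx
  have hbdd : BddAbove ((fun o : Ordinal.{0} => o + 1) '' A) := by
    refine ⟨l, ?_⟩
    rintro _ ⟨z, hz, rfl⟩
    exact Order.add_one_le_of_lt (hA.1 hz)
  exact lt_of_lt_of_le (Order.lt_add_one_iff.2 hxy) (le_csSup hbdd ⟨y, hy, rfl⟩)

theorem inUlt_of_forall_inter_Iio (hU : IsNormalUltrafilter δ U) {l : Ordinal.{0}}
    (hl : Order.IsSuccLimit l) {F : Ultrafilter (Idx l.cof)}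
    (hF : IsCComplete (Order.succ ((2 : Cardinal.{0}) ^ δ)) (F : Filter (Idx l.cof)))
    (hcob : ∀ s : Set (Idx l.cof),
      (∃ b < l.cof.ord, ∀ i : Idx l.cof, b ≤ i.1 → i ∈ s) → s ∈ F)
    {A : Set Ordinal.{0}} (hAl : A ⊆ Iio l) (hA : ∀ α < l, InUlt hU (A ∩ Iio α)) :
    InUlt hU A := by
  obtain ⟨a, hal, ha⟩ := exists_cofinal_sequence hl
  choose g hg using fun ξ => ordRank_surjective hU (a ξ)
  choose f hfb hf using fun ξ => hA (a ξ) (hal ξ)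
  obtain ⟨gl, hgl⟩ := ordRank_surjective hU l
  let c : Idx l.cof → Idx l.cof → Set (Idx δ) := fun ξ η =>
    { i | f η i ∩ Iio (g ξ i) = f ξ i }
  have hc : ∀ ξ, { η | c ξ η ∈ U } ∈ F := by
    intro ξ
    obtain ⟨b, hb, hbξ⟩ := ha (a ξ) (hal ξ)
    refine hcob _ ⟨b, hb, fun η hη => (ultSet_eq_iff hU).1 ?_⟩
    rw [ultSet_inter_Iio, ← hf, ← hf, hg, inter_assoc, Iio_inter_Iio,
      min_eq_right (hbξ η hη).le]
  choose W hW using fun ξ => exists_fiber_mem hF (c ξ)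
  obtain ⟨V, hV⟩ := exists_fiber_mem hF W
  have hVU : V ∈ U := by
    obtain ⟨ξ, hξ⟩ := Ultrafilter.nonempty_of_mem hV
    obtain ⟨η, hη, hη'⟩ := Ultrafilter.nonempty_of_mem (Filter.inter_mem (hW ξ) (hc ξ))
    have h : c ξ η = V := Eq.trans hη hξ
    exact h ▸ hη'
  let H : Set (Idx l.cof) := { ξ | W ξ = V }
  have hcoh : ∀ ξ ∈ H, ∀ i ∈ V, (⋃ ζ ∈ H, f ζ i) ∩ Iio (g ξ i) = f ξ i := by
    intro ξ hξ i hi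
    have key : ∀ ζ ∈ H, ∃ η, f η i ∩ Iio (g ξ i) = f ξ i ∧ f η i ∩ Iio (g ζ i) = f ζ i := by
      intro ζ hζ
      obtain ⟨η, h₁, h₂⟩ := Ultrafilter.nonempty_of_mem (Filter.inter_mem (hW ξ) (hW ζ))
      have h₁' : c ξ η = V := Eq.trans h₁ hξ
      have h₂' : c ζ η = V := Eq.trans h₂ hζ
      exact ⟨η, h₁'.ge hi, h₂'.ge hi⟩
    ext x
    simp only [mem_inter_iff, mem_iUnion, exists_prop]
    constructor
    · rintro ⟨⟨ζ, hζ, hx⟩, hxg⟩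
      obtain ⟨η, h₁, h₂⟩ := key ζ hζ
      rw [← h₂] at hx
      exact h₁ ▸ ⟨hx.1, hxg⟩
    · intro hx
      obtain ⟨η, h₁, -⟩ := key ξ hξ
      exact ⟨⟨ξ, hξ, hx⟩, (h₁ ▸ hx : x ∈ f η i ∩ Iio (g ξ i)).2⟩
  have hinter : ∀ ξ ∈ H, ultSet hU (fun i => ⋃ ζ ∈ H, f ζ i) ∩ Iio (a ξ) = A ∩ Iio (a ξ) := by
    intro ξ hξ
    rw [hf ξ, ← hg ξ, ← ultSet_inter_Iio]
    exact ultSet_congr hU (Filter.mem_of_superset hVU (hcoh ξ hξ))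
  refine ⟨fun i => (⋃ ζ ∈ H, f ζ i) ∩ Iio (gl i),
    fun i => bddAbove_Iio.mono inter_subset_right, ?_⟩
  rw [ultSet_inter_Iio, hgl]
  ext x
  have hx : x < l → (x ∈ A ↔ x ∈ ultSet hU (fun i => ⋃ ζ ∈ H, f ζ i)) := by
    intro hxl
    obtain ⟨ξ, hξ, hξx⟩ := Ultrafilter.nonempty_of_mem (Filter.inter_mem hV (hcob _ (ha x hxl)))
    have h := Set.ext_iff.1 (hinter ξ hξ) x
    simp only [mem_inter_iff, mem_Iio, show x < a ξ from hξx, and_true] at h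
    exact h.symm
  exact ⟨fun h => ⟨(hx (hAl h)).1 h, hAl h⟩, fun h => (hx h.2).2 h.1⟩

/-- If `cof(λ) > 2^δ` and there is a `<(2^δ)⁺`-closed ultrafilter on `cof(λ)`
containing all cobounded subsets of `cof(λ)`, then no unbounded subset of `λ` is fresh
over `Ult(V,U)`. -/
theorem stmt1 (δ : Cardinal.{0}) (U : Ultrafilter (Idx δ)) (hU : IsNormalUltrafilter δ U)
    (l : Ordinal.{0}) (hl : Order.IsSuccLimit l)
    (hcof : (2 : Cardinal.{0}) ^ δ < l.cof)
    (hF : ∃ F : Ultrafilter (Idx l.cof),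
        IsCComplete (Order.succ ((2 : Cardinal.{0}) ^ δ)) (F : Filter (Idx l.cof)) ∧
        ∀ s : Set (Idx l.cof),
          (∃ b < l.cof.ord, ∀ i : Idx l.cof, b ≤ i.1 → i ∈ s) → s ∈ F) :
    ¬ ∃ A : Set Ordinal.{0}, UnbSub A l ∧ Fresh hU A := by
  rintro ⟨A, hA, hnot, hfresh⟩
  obtain ⟨F, hFc, hFb⟩ := hF
  exact hnot (inUlt_of_forall_inter_Iio hU hl hFc hFb hA.1 fun α hα =>
    hfresh α (lt_lub_of_unbSub hA hα))

end MU
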